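/- Let G be a finite non-abelian p-group. Then Aut_l(G) = Inn(G) if and only if the commutator subgroup G′ is contained in L(G), L(G) is cyclic, and Z(G) = L(G)·G^{p^n}, where p^n = exp(L(G)). -/

import Mathlib

/-- The absolute centre `L(G)`: elements fixed by every automorphism of `G`. -/
def absoluteCenter (G : Type*) [Group G] : Subgroup G where
  carrier := {g | ∀ α : MulAut G, α g = g}
  one_mem' := fun α => map_one α
  mul_mem' := fun {a b} ha hb α => by rw [map_mul, ha α, hb α]
  inv_mem' := fun {a} ha α => by rw [map_inv, ha α]

/-- The group `Aut_l(G)` of absolute central automorphisms of `G`. -/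
def absCentralAut (G : Type*) [Group G] : Subgroup (MulAut G) where
  carrier := {α | ∀ g : G, g⁻¹ * α g ∈ absoluteCenter G}
  one_mem' := fun g => by simpa using (absoluteCenter G).one_mem
  mul_mem' := fun {α β} hα hβ g => by
    have h : g⁻¹ * (α * β) g = (g⁻¹ * β g) * ((β g)⁻¹ * α (β g)) := by
      simp [MulAut.mul_apply, mul_assoc]
    rw [h]; exact mul_mem (hβ g) (hα (β g))
  inv_mem' := fun {α} hα g => by
    have h : g⁻¹ * α⁻¹ g = ((α⁻¹ g)⁻¹ * α (α⁻¹ g))⁻¹ := by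
      simp [MulAut.inv_def, mul_assoc]
    rw [h]; exact inv_mem (hα (α⁻¹ g))

/-- The subgroup `G^m` generated by all `m`-th powers of elements of `G`. -/
def powSubgroup (G : Type*) [Group G] (m : ℕ) : Subgroup G :=
  Subgroup.closure {x : G | ∃ g : G, g ^ m = x}

section CyclicTarget

/-- A cyclic group, seen as a commutative monoid, has all roots of unity of order its
cardinality. -/
theorem IsCyclic.hasEnoughRootsOfUnity_natCard (C : Type*) [CommGroup C] [IsCyclic C] :
    HasEnoughRootsOfUnity C (Nat.card C) where
  prim := by
    obtain ⟨c, hc⟩ := IsCyclic.exists_generator (α := C)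
    exact ⟨c, orderOf_eq_card_of_forall_mem_zpowers hc ▸ IsPrimitiveRoot.orderOf c⟩
  cyc := by
    have : IsCyclic Cˣ := isCyclic_of_surjective (toUnits (G := C)) toUnits.surjective
    infer_instance

/-- A finite abelian group `A` has exactly `|A|` homomorphisms to a finite cyclic group whose order
is a multiple of the exponent of `A`. -/
theorem CommGroup.card_monoidHom_of_isCyclic (A C : Type*) [CommGroup A] [Finite A] [CommGroup C]
    [Finite C] [IsCyclic C] (h : Monoid.exponent A ∣ Nat.card C) :
    Nat.card (A →* C) = Nat.card A := by
  have := IsCyclic.hasEnoughRootsOfUnity_natCard C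
  have : NeZero (Nat.card C) := ⟨Nat.card_pos.ne'⟩
  have := HasEnoughRootsOfUnity.of_dvd C h
  rw [← CommGroup.card_monoidHom_of_hasEnoughRootsOfUnity A C]
  exact Nat.card_congr (toUnits (G := C)).monoidHomCongrRight.toEquiv

/-- Homomorphisms out of `G ⧸ H` are homomorphisms out of `G` which are trivial on `H`. -/
def QuotientGroup.homEquiv {G K : Type*} [Group G] [Group K] (H : Subgroup G) [H.Normal] :
    {f : G →* K // H ≤ f.ker} ≃ (G ⧸ H →* K) where
  toFun f := QuotientGroup.lift H f.1 f.2
  invFun φ := ⟨φ.comp (QuotientGroup.mk' H), fun x hx => by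
    simp [MonoidHom.mem_ker, (QuotientGroup.eq_one_iff x).2 hx]⟩
  left_inv f := by ext; rfl
  right_inv φ := by ext; rfl

theorem Subgroup.card_monoidHom_trivial_on {G C : Type*} [Group G] [Finite G] [Group C] [Finite C]
    [IsCyclic C] {H : Subgroup G} (hH : _root_.commutator G ≤ H) (hpow : ∀ g : G, g ^ Nat.card C ∈ H) :
    Nat.card {f : G →* C // H ≤ f.ker} = H.index := by
  have hN : H.Normal := .of_commutator_le _ hH
  have hcomm := Subgroup.Normal.quotient_commutative_iff_commutator_le.2 hH
  let _ : CommGroup (G ⧸ H) := { QuotientGroup.Quotient.group H with mul_comm := mul_comm' }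
  let _ : CommGroup C := IsCyclic.commGroup
  rw [Nat.card_congr (QuotientGroup.homEquiv H), Subgroup.index]
  refine CommGroup.card_monoidHom_of_isCyclic (G ⧸ H) C
    (Monoid.exponent_dvd_of_forall_pow_eq_one fun x => ?_)
  obtain ⟨g, rfl⟩ := QuotientGroup.mk_surjective x
  exact (QuotientGroup.eq_one_iff _).2 (hpow g)

end CyclicTarget

section PGroup

/-- In a finite `p`-group in which `c` is central of maximal order, if `c` does not generate the
group then there is an element of order `p` outside the subgroup generated by `c`. -/
theorem IsPGroup.exists_orderOf_eq_prime_notMem_zpowers {p : ℕ} [Fact p.Prime] {A : Type*} [Group A]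
    [Finite A] (hA : IsPGroup p A) {c : A} (hc : orderOf c = Monoid.exponent A)
    (hcomm : ∀ x, Commute x c) (hne : ∃ x, x ∉ Subgroup.zpowers c) :
    ∃ y, y ∉ Subgroup.zpowers c ∧ orderOf y = p := by
  have hp : p.Prime := Fact.out
  obtain ⟨x, hx, hxp⟩ : ∃ x, x ∉ Subgroup.zpowers c ∧ x ^ p ∈ Subgroup.zpowers c := by
    obtain ⟨x, hx⟩ := hne
    by_contra! h
    have key : ∀ k, x ^ p ^ k ∉ Subgroup.zpowers c := fun k => by
      induction k with
      | zero => simpa using hx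
      | succ k ih => simpa [pow_succ, pow_mul] using h _ ih
    obtain ⟨k, hk⟩ := hA x
    exact key k (hk ▸ one_mem _)
  obtain ⟨k, hk⟩ := Subgroup.mem_zpowers_iff.1 hxp
  have hpm : p ∣ orderOf c := by
    rw [hc]
    obtain ⟨n, hn⟩ := (IsPGroup.iff_orderOf.1 hA) x
    refine dvd_trans ?_ (Monoid.order_dvd_exponent x)
    rw [hn]
    refine dvd_pow_self p fun h => hx ?_
    rw [h, pow_zero, orderOf_eq_one_iff] at hn
    exact hn ▸ one_mem _
  obtain ⟨m, hm⟩ := hpm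
  have hm0 : (m : ℤ) ≠ 0 := by
    rintro h
    have := (orderOf_pos c).ne'
    simp_all
  have hpk : (p : ℤ) ∣ k := by
    have h1 : c ^ (k * m) = 1 := by
      rw [zpow_mul, hk, zpow_natCast, ← pow_mul, ← hm, hc, Monoid.pow_exponent_eq_one]
    have h2 := orderOf_dvd_iff_zpow_eq_one.2 h1
    rw [hm, Nat.cast_mul] at h2
    exact (mul_dvd_mul_iff_right hm0).1 h2
  obtain ⟨l, rfl⟩ := hpk
  have hy : x * c ^ (-l) ∉ Subgroup.zpowers c := fun h =>
    hx ((Subgroup.mul_mem_cancel_right _ (Subgroup.zpow_mem_zpowers c (-l))).1 h)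
  refine ⟨x * c ^ (-l), hy, orderOf_eq_prime ?_ fun h => hy (h ▸ one_mem _)⟩
  rw [((hcomm x).zpow_right (-l)).mul_pow, ← hk, ← zpow_natCast, ← zpow_mul, ← zpow_add]
  simp [mul_comm]

end PGroup

section AbsoluteCenter

variable {G : Type*} [Group G]

theorem absoluteCenter_le_center : absoluteCenter G ≤ Subgroup.center G := fun z hz =>
  Subgroup.mem_center_iff.2 fun g => by
    have := hz (MulAut.conj g)
    rwa [MulAut.conj_apply, mul_inv_eq_iff_eq_mul] at this

theorem commute_of_mem_absoluteCenter {z : G} (hz : z ∈ absoluteCenter G) (g : G) : Commute g z :=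
  Subgroup.mem_center_iff.1 (absoluteCenter_le_center hz) g

/-- The homomorphism `g ↦ g⁻¹ * α g` attached to an absolute central automorphism `α`. -/
def absCentralAutHom (α : absCentralAut G) : G →* absoluteCenter G where
  toFun g := ⟨g⁻¹ * α.1 g, α.2 g⟩
  map_one' := by ext; simp
  map_mul' g h := by
    ext
    have := (commute_of_mem_absoluteCenter (α.2 g) h⁻¹).eq
    simp only [map_mul, mul_inv_rev, Subgroup.coe_mul]
    rw [mul_assoc, ← mul_assoc g⁻¹, ← mul_assoc, this, mul_assoc]

/-- The absolute central automorphism `g ↦ g * f g` attached to a homomorphism `f` from `G` to its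
absolute centre which is trivial on the absolute centre. -/
noncomputable def absCentralAutOfHom [Finite G] (f : G →* absoluteCenter G)
    (hf : absoluteCenter G ≤ f.ker) : absCentralAut G := by
  let φ : G →* G :=
    { toFun := fun g => g * f g
      map_one' := by simp
      map_mul' := fun g h => by
        have := (commute_of_mem_absoluteCenter (f g).2 h).eq
        simp only [map_mul, Subgroup.coe_mul]
        rw [mul_assoc, ← mul_assoc h, this]
        simp only [mul_assoc] }
  have hφ : Function.Injective φ := (injective_iff_map_eq_one φ).2 fun g hg => by
    have hg' : g * f g = 1 := hg
    have hgL : g ∈ absoluteCenter G := by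
      rw [eq_inv_of_mul_eq_one_left hg']
      exact inv_mem (f g).2
    simpa [MonoidHom.mem_ker.1 (hf hgL)] using hg'
  refine ⟨MulEquiv.ofBijective φ (Finite.injective_iff_bijective.1 hφ), fun g => ?_⟩
  simp [φ]

/-- Absolute central automorphisms correspond to homomorphisms from `G` to its absolute centre
which are trivial on the absolute centre. -/
noncomputable def absCentralAutEquiv (G : Type*) [Group G] [Finite G] :
    absCentralAut G ≃ {f : G →* absoluteCenter G // absoluteCenter G ≤ f.ker} where
  toFun α := ⟨absCentralAutHom α, fun z hz => by
    ext
    simp [absCentralAutHom, hz α.1]⟩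
  invFun f := absCentralAutOfHom f.1 f.2
  left_inv α := by
    ext g
    simp [absCentralAutHom, absCentralAutOfHom]
  right_inv f := by
    ext g
    simp [absCentralAutHom, absCentralAutOfHom]

theorem center_le_ker_absCentralAutHom {α : absCentralAut G}
    (hα : α.1 ∈ (MulAut.conj : G →* MulAut G).range) :
    Subgroup.center G ≤ (absCentralAutHom α).ker := fun z hz => by
  obtain ⟨x, hx⟩ := hα
  ext
  simp [absCentralAutHom, ← hx, Subgroup.mem_center_iff.1 hz x]

theorem card_range_conj (G : Type*) [Group G] :
    Nat.card (MulAut.conj : G →* MulAut G).range = (Subgroup.center G).index := by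
  rw [← Subgroup.index_ker]
  congr 1
  ext z
  simp only [MonoidHom.mem_ker, Subgroup.mem_center_iff, MulEquiv.ext_iff, MulAut.conj_apply,
    MulAut.one_apply, mul_inv_eq_iff_eq_mul]
  exact forall_congr' fun _ => eq_comm

theorem range_conj_le_absCentralAut_iff :
    (MulAut.conj : G →* MulAut G).range ≤ absCentralAut G ↔
      commutator G ≤ absoluteCenter G := by
  rw [commutator_def, Subgroup.commutator_le]
  constructor
  · intro h x _ g _
    have := h ⟨g, rfl⟩ x⁻¹
    simpa [commutatorElement_def, mul_assoc] using this
  · rintro h _ ⟨x, rfl⟩ g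
    have := h g⁻¹ trivial x trivial
    simpa [commutatorElement_def, mul_assoc] using this

theorem pow_exponent_absoluteCenter_mem_center (hG' : commutator G ≤ absoluteCenter G) (g : G) :
    g ^ Monoid.exponent (absoluteCenter G) ∈ Subgroup.center G := by
  refine Subgroup.mem_center_iff.2 fun x => ?_
  have h := map_pow (absCentralAutHom ⟨MulAut.conj x,
    range_conj_le_absCentralAut_iff.2 hG' ⟨x, rfl⟩⟩) g (Monoid.exponent (absoluteCenter G))
  rw [Monoid.pow_exponent_eq_one, Subtype.ext_iff] at h
  have h' := inv_mul_eq_one.1 h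
  rw [MulAut.conj_apply, eq_mul_inv_iff_mul_eq] at h'
  exact h'.symm

theorem powSubgroup_le_iff {m : ℕ} {H : Subgroup G} :
    powSubgroup G m ≤ H ↔ ∀ g : G, g ^ m ∈ H := by
  simp [powSubgroup, Subgroup.closure_le, Set.subset_def]

/-- If every absolute central automorphism is inner then the absolute centre is cyclic. -/
theorem isCyclic_absoluteCenter {p : ℕ} [Fact p.Prime] [Finite G] (hG : IsPGroup p G)
    (hG' : commutator G ≤ absoluteCenter G) (hZ : Subgroup.center G ≠ ⊤)
    (hcard : Nat.card {f : G →* absoluteCenter G // Subgroup.center G ≤ f.ker} =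
      (Subgroup.center G).index) : IsCyclic (absoluteCenter G) := by
  have hp : p.Prime := Fact.out
  obtain ⟨c, hc⟩ := @Monoid.exists_orderOf_eq_exponent (absoluteCenter G)
    { (inferInstance : Group (absoluteCenter G)) with
      mul_comm := fun a b => Subtype.ext (commute_of_mem_absoluteCenter b.2 a.1).eq }
    Monoid.ExponentExists.of_finite
  have hcardC : Nat.card {f : G →* Subgroup.zpowers c // Subgroup.center G ≤ f.ker} =
      (Subgroup.center G).index := by
    refine Subgroup.card_monoidHom_trivial_on (hG'.trans absoluteCenter_le_center) fun g => ?_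
    rw [Nat.card_zpowers, hc]
    exact pow_exponent_absoluteCenter_mem_center hG' g
  have : Finite (G →* absoluteCenter G) := .of_injective _ DFunLike.coe_injective
  have : Finite (G →* Subgroup.zpowers c) := .of_injective _ DFunLike.coe_injective
  let F : {f : G →* Subgroup.zpowers c // Subgroup.center G ≤ f.ker} →
      {f : G →* absoluteCenter G // Subgroup.center G ≤ f.ker} := fun f =>
    ⟨(Subgroup.zpowers c).subtype.comp f.1, fun z hz => by
      simp [MonoidHom.mem_ker, MonoidHom.mem_ker.1 (f.2 hz)]⟩
  have hF : Function.Injective F := fun f₁ f₂ h => by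
    ext g
    simpa [F] using congrArg (fun f => ((f.1 g : absoluteCenter G) : G)) h
  have hFs : Function.Surjective F :=
    ((Nat.bijective_iff_injective_and_card F).2 ⟨hF, hcardC.trans hcard.symm⟩).2
  have hrange : ∀ f : G →* absoluteCenter G, Subgroup.center G ≤ f.ker →
      ∀ g, f g ∈ Subgroup.zpowers c := fun f hf g => by
    obtain ⟨f', hf'⟩ := hFs ⟨f, hf⟩
    obtain rfl : (F f').1 = f := congrArg Subtype.val hf'
    exact (f'.1 g).2
  refine ⟨c, ?_⟩
  by_contra hne
  obtain ⟨y, hyc, hyp⟩ := (hG.to_subgroup (absoluteCenter G)).exists_orderOf_eq_prime_notMem_zpowers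
    hc (fun x => Subtype.ext (commute_of_mem_absoluteCenter c.2 x.1).eq) (not_forall.1 hne)
  obtain ⟨⟨f, hf⟩, hf1⟩ : ∃ f : {f : G →* Subgroup.zpowers c // Subgroup.center G ≤ f.ker},
      f ≠ ⟨1, by simp⟩ := by
    have : Nontrivial {f : G →* Subgroup.zpowers c // Subgroup.center G ≤ f.ker} := by
      rw [← Finite.one_lt_card_iff_nontrivial, hcardC]
      exact Subgroup.one_lt_index_of_ne_top hZ
    exact exists_ne _
  obtain ⟨r, hr⟩ := IsCyclic.exists_generator (α := f.range)
  obtain ⟨g, hg⟩ := f.rangeRestrict_surjective r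
  have hpr : orderOf y ∣ orderOf r := by
    obtain ⟨n, hn⟩ := IsPGroup.iff_orderOf.1
      (((hG.to_subgroup _).to_subgroup (Subgroup.zpowers c)).to_subgroup f.range) r
    rw [hyp, hn]
    refine dvd_pow_self p fun h => hf1 ?_
    rw [h, pow_zero, orderOf_eq_one_iff] at hn
    subst hn
    refine Subtype.ext (MonoidHom.ext fun x => ?_)
    have hx := hr (f.rangeRestrict x)
    rw [Subgroup.zpowers_one_eq_bot, Subgroup.mem_bot] at hx
    exact congrArg Subtype.val hx
  refine hyc ?_
  have := hrange ((monoidHomOfForallMemZpowers hr hpr).comp f.rangeRestrict) (fun z hz => ?_) g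
  · rwa [MonoidHom.comp_apply, hg, monoidHomOfForallMemZpowers_apply_gen] at this
  · have hz' : f.rangeRestrict z = 1 := Subtype.ext (hf hz)
    rw [MonoidHom.mem_ker, MonoidHom.comp_apply, hz', map_one]

end AbsoluteCenter

/-- Let `G` be a finite non-abelian `p`-group.  Then `Aut_l(G) = Inn(G)` if and only if
`G' ≤ L(G)`, `L(G)` is cyclic, and `Z(G) = L(G) * G ^ (p ^ n)`, where
`p ^ n = exp(L(G))`. -/
theorem absCentralAut_eq_inn_iff {p : ℕ} [Fact p.Prime] (G : Type*) [Group G] [Finite G]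
    (hG : IsPGroup p G) (hna : ∃ a b : G, a * b ≠ b * a) :
    absCentralAut G = (MulAut.conj : G →* MulAut G).range ↔
      commutator G ≤ absoluteCenter G ∧ IsCyclic (absoluteCenter G) ∧
        Subgroup.center G =
          absoluteCenter G ⊔ powSubgroup G (Monoid.exponent (absoluteCenter G)) := by
  have hLZ := absoluteCenter_le_center (G := G)
  have : Finite (G →* absoluteCenter G) := .of_injective _ DFunLike.coe_injective
  constructor
  · intro h
    have hG' := range_conj_le_absCentralAut_iff.1 h.ge
    have hker : ∀ f : G →* absoluteCenter G, absoluteCenter G ≤ f.ker →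
        Subgroup.center G ≤ f.ker := fun f hf => by
      obtain ⟨α, hα⟩ := (absCentralAutEquiv G).surjective ⟨f, hf⟩
      obtain rfl : absCentralAutHom α = f := congrArg Subtype.val hα
      exact center_le_ker_absCentralAutHom (h ▸ α.2)
    have hcard : Nat.card {f : G →* absoluteCenter G // Subgroup.center G ≤ f.ker} =
        (Subgroup.center G).index := by
      rw [← card_range_conj, ← h, Nat.card_congr (absCentralAutEquiv G)]
      exact Nat.card_congr (Equiv.subtypeEquivRight fun f => ⟨hLZ.trans, hker f⟩)
    have hcyc := isCyclic_absoluteCenter hG hG' (fun hZ => by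
      obtain ⟨a, b, hab⟩ := hna
      exact hab (Subgroup.mem_center_iff.1 (hZ ▸ Subgroup.mem_top b) a)) hcard
    refine ⟨hG', hcyc, ?_⟩
    have hle : absoluteCenter G ⊔ powSubgroup G (Monoid.exponent (absoluteCenter G)) ≤
        Subgroup.center G :=
      sup_le hLZ (powSubgroup_le_iff.2 (pow_exponent_absoluteCenter_mem_center hG'))
    refine le_antisymm ?_ hle
    have hindex := Subgroup.card_monoidHom_trivial_on (C := absoluteCenter G)
      (hG'.trans (le_sup_left (b := powSubgroup G (Monoid.exponent (absoluteCenter G)))))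
      fun g => IsCyclic.exponent_eq_card (α := absoluteCenter G) ▸
        le_sup_right (a := absoluteCenter G) (powSubgroup_le_iff.1 le_rfl g)
    rw [← Subgroup.relIndex_eq_one]
    have hmul := Subgroup.relIndex_mul_index hle
    rw [← hindex, Nat.card_congr (Equiv.subtypeEquivRight fun f =>
      ⟨fun hf => hker f (le_sup_left.trans hf), hle.trans⟩), hcard] at hmul
    exact (Nat.mul_eq_right Subgroup.index_ne_zero_of_finite).1 hmul
  · rintro ⟨hG', hcyc, hZ⟩
    refine (Subgroup.eq_of_le_of_card_ge (range_conj_le_absCentralAut_iff.2 hG') ?_).symm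
    rw [card_range_conj, Nat.card_congr (absCentralAutEquiv G),
      ← Subgroup.card_monoidHom_trivial_on (C := absoluteCenter G) (hG'.trans hLZ)
        fun g => IsCyclic.exponent_eq_card (α := absoluteCenter G) ▸
          pow_exponent_absoluteCenter_mem_center hG' g]
    refine (Nat.card_congr (Equiv.subtypeEquivRight fun f => ⟨fun hf => ?_, hLZ.trans⟩)).le
    rw [hZ]
    refine sup_le hf (powSubgroup_le_iff.2 fun g => ?_)
    rw [MonoidHom.mem_ker, map_pow, Monoid.pow_exponent_eq_one]
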